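/- arXiv:2602.23185 — 2 statements merged into one kernel-verified Lean document; each statement's English description precedes it below -/
import Mathlib

section
/- Let 2 ≤ k ≤ n and let λ ∈ ℝⁿ lie in the closure of the Gårding cone Γ_k, with entries ordered λ₁ ≥ λ₂ ≥ ⋯ ≥ λ_n. Then 0 ≤ σ_{k-1;1}(λ) ≤ σ_{k-1;2}(λ) ≤ ⋯ ≤ σ_{k-1;n}(λ). -/
/-- The `m`-th elementary symmetric polynomial of `λ ∈ ℝⁿ`. -/
noncomputable def esymm (n m : ℕ) (lam : Fin n → ℝ) : ℝ :=
  ∑ s ∈ Finset.powersetCard m (Finset.univ : Finset (Fin n)), ∏ i ∈ s, lam i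

/-- The Gårding cone `Γ_k`. -/
def GardingCone (n k : ℕ) : Set (Fin n → ℝ) :=
  {lam | ∀ j, 1 ≤ j → j ≤ k → 0 < esymm n j lam}

/-- `σ_{m;i}(λ)`: the `m`-th elementary symmetric polynomial of `λ` with the entry
`λ_i` replaced by `0`. -/
noncomputable def esymmDel (n m : ℕ) (i : Fin n) (lam : Fin n → ℝ) : ℝ :=
  esymm n m (Function.update lam i 0)

open Polynomial in
/-- The generating polynomial `∏ (1 + λ_i X)` of the elementary symmetric polynomials. -/
noncomputable def esymmGen (n : ℕ) (lam : Fin n → ℝ) : ℝ[X] :=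
  ∏ i, (1 + C (lam i) * X)

open Polynomial in
theorem coeff_esymmGen (n m : ℕ) (lam : Fin n → ℝ) :
    (esymmGen n lam).coeff m = esymm n m lam := by
  simp only [esymmGen, esymm, Finset.prod_one_add, Finset.prod_mul_distrib, Finset.prod_const,
    finsetSum_coeff, ← map_prod, coeff_C_mul_X_pow]
  rw [← Finset.sum_filter]
  refine Finset.sum_congr ?_ fun _ _ => rfl
  ext s
  simp [Finset.mem_powersetCard, eq_comm]

open Polynomial in
theorem splits_esymmGen (n : ℕ) (lam : Fin n → ℝ) : (esymmGen n lam).Splits := by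
  refine Splits.prod fun i _ => Splits.of_natDegree_le_one ?_
  compute_degree

/-- Expansion of `σ_{m+1}` along the `i`-th entry. -/
theorem esymm_succ_eq_update (n m : ℕ) (i : Fin n) (lam : Fin n → ℝ) :
    esymm n (m + 1) lam = esymm n (m + 1) (Function.update lam i 0)
      + lam i * esymm n m (Function.update lam i 0) := by
  have h : esymmGen n lam = esymmGen n (Function.update lam i 0)
      * (1 + Polynomial.C (lam i) * Polynomial.X) := by
    unfold esymmGen
    rw [← Finset.mul_prod_erase _ _ (Finset.mem_univ i),
      ← Finset.mul_prod_erase _ (fun j => 1 + Polynomial.C (Function.update lam i 0 j) *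
        Polynomial.X) (Finset.mem_univ i), mul_comm]
    congr 1
    simp only [Function.update_self, map_zero, zero_mul, add_zero, one_mul]
    refine Finset.prod_congr rfl fun j hj => ?_
    rw [Function.update_of_ne (Finset.ne_of_mem_erase hj)]
  simp only [← coeff_esymmGen]
  rw [h, mul_add, mul_one, Polynomial.coeff_add, mul_left_comm, Polynomial.coeff_C_mul,
    Polynomial.coeff_mul_X]

open Polynomial in
theorem splits_derivative_of_splits {p : ℝ[X]} (hp : p.Splits) : (derivative p).Splits := by
  rw [splits_iff_card_roots] at hp ⊢
  have h1 := card_roots_le_derivative p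
  have h2 := natDegree_derivative_le p
  have h3 := card_roots' (derivative p)
  omega

open Polynomial in
/-- Laguerre's inequality for real-rooted polynomials. -/
theorem laguerre_inequality {p : ℝ[X]} (hp : p.Splits) (x : ℝ) :
    p.eval x * (derivative (derivative p)).eval x ≤ (derivative p).eval x ^ 2 := by
  obtain ⟨m, hm⟩ := splits_iff_exists_multiset.1 hp
  have key : ∀ (s : Multiset ℝ) (c : ℝ), ∀ q : ℝ[X], q = C c * (s.map (X - C ·)).prod →
      q.eval x * (derivative (derivative q)).eval x ≤ (derivative q).eval x ^ 2 := by
    intro s c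
    induction s using Multiset.induction_on with
    | empty => rintro q rfl; simp
    | cons a s ih =>
      rintro q rfl
      have h := ih _ rfl
      set r := C c * (s.map (X - C ·)).prod
      have hq : C c * ((a ::ₘ s).map (X - C ·)).prod = (X - C a) * r := by
        simp only [Multiset.map_cons, Multiset.prod_cons, r]; ring
      rw [hq]
      simp only [derivative_mul, derivative_add, derivative_sub, derivative_X, derivative_C,
        eval_add, eval_mul, eval_sub, eval_X, eval_C, sub_zero, one_mul]
      nlinarith [sq_nonneg (r.eval x), mul_le_mul_of_nonneg_left h (sq_nonneg (x - a))]
  exact key m _ p hm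

open Polynomial in
/-- A weak form of Newton's inequality. -/
theorem esymm_newton (n j : ℕ) (lam : Fin n → ℝ) :
    ((j : ℝ) + 2) * (esymm n j lam * esymm n (j + 2) lam)
      ≤ ((j : ℝ) + 1) * esymm n (j + 1) lam ^ 2 := by
  have hs : ∀ m, (derivative^[m] (esymmGen n lam)).Splits := fun m => by
    induction m with
    | zero => exact splits_esymmGen n lam
    | succ m ih =>
      rw [Function.iterate_succ_apply']
      exact splits_derivative_of_splits ih
  have he : ∀ m, (derivative^[m] (esymmGen n lam)).eval 0 = m.factorial * esymm n m lam := by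
    intro m
    rw [← coeff_zero_eq_eval_zero, coeff_iterate_derivative, coeff_esymmGen, zero_add,
      Nat.descFactorial_self, nsmul_eq_mul]
  have h := laguerre_inequality (hs j) 0
  rw [← Function.iterate_succ_apply' derivative, ← Function.iterate_succ_apply' derivative,
    he, he, he] at h
  have hf : (0 : ℝ) < (j.factorial : ℝ) ^ 2 * (j + 1) := by positivity
  simp only [Nat.succ_eq_add_one, Nat.factorial_succ] at h
  push_cast at h
  refine le_of_mul_le_mul_left ?_ hf
  linarith

theorem update_mem_gardingCone {n k : ℕ} {lam : Fin n → ℝ} (h : lam ∈ GardingCone n (k + 1))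
    (i : Fin n) : Function.update lam i 0 ∈ GardingCone n k := by
  have key : ∀ j ≤ k, 0 < esymm n j (Function.update lam i 0) := by
    intro j
    induction j with
    | zero => intro _; simp [esymm]
    | succ j ih =>
      intro hj
      have ha := ih (by omega)
      have h1 := h (j + 1) (by omega) (by omega)
      have h2 := h (j + 2) (by omega) (by omega)
      have hN := esymm_newton n j (Function.update lam i 0)
      rw [esymm_succ_eq_update n _ i] at h1 h2
      by_contra! hb
      generalize esymm n j (Function.update lam i 0) = a at *
      generalize esymm n (j + 1) (Function.update lam i 0) = b at *
      generalize esymm n (j + 2) (Function.update lam i 0) = c at *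
      have h3 : b ^ 2 < a * c := by nlinarith [mul_pos ha h2]
      have hj0 : (0 : ℝ) ≤ j := Nat.cast_nonneg j
      nlinarith [sq_nonneg b, mul_nonneg hj0 (sub_nonneg.2 h3.le)]
  exact fun j _ hj => key j hj

theorem continuous_esymm (n m : ℕ) : Continuous (esymm n m) := by
  unfold esymm
  fun_prop

theorem update_mem_closure_gardingCone {n k : ℕ} {lam : Fin n → ℝ}
    (h : lam ∈ closure (GardingCone n (k + 1))) (i : Fin n) :
    Function.update lam i 0 ∈ closure (GardingCone n k) :=
  map_mem_closure (f := fun v : Fin n → ℝ => Function.update v i 0)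
    (continuous_id.update i continuous_const) h fun _ hv => update_mem_gardingCone hv i

theorem esymm_nonneg_of_mem_closure {n k : ℕ} {lam : Fin n → ℝ}
    (h : lam ∈ closure (GardingCone n k)) : 0 ≤ esymm n k lam := by
  refine closure_minimal (fun v hv => ?_)
    (isClosed_le continuous_const (continuous_esymm n k)) h
  rcases Nat.eq_zero_or_pos k with rfl | hk
  · simp [esymm]
  · exact (hv k hk le_rfl).le

/-- for `2 ≤ k ≤ n` and `λ` in the closure of `Γ_k` with entries ordered
`λ₁ ≥ λ₂ ≥ ⋯ ≥ λ_n`, one has `0 ≤ σ_{k-1;1}(λ) ≤ σ_{k-1;2}(λ) ≤ ⋯ ≤ σ_{k-1;n}(λ)`. -/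
theorem stmt3 (n k : ℕ) (hk : 2 ≤ k) (hkn : k ≤ n) (lam : Fin n → ℝ)
    (hlam : lam ∈ closure (GardingCone n k)) (hdec : Antitone lam) :
    0 ≤ esymmDel n (k - 1) ⟨0, by omega⟩ lam ∧
      Monotone (fun i : Fin n => esymmDel n (k - 1) i lam) := by
  obtain ⟨k, rfl⟩ := Nat.exists_eq_add_of_le' hk
  refine ⟨esymm_nonneg_of_mem_closure (update_mem_closure_gardingCone hlam _), fun i j hij => ?_⟩
  rcases eq_or_ne i j with rfl | hne
  · exact le_rfl
  have hnn := esymm_nonneg_of_mem_closure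
    (update_mem_closure_gardingCone (update_mem_closure_gardingCone hlam i) j)
  change esymm n (k + 1) _ ≤ esymm n (k + 1) _
  rw [esymm_succ_eq_update n k j (Function.update lam i 0),
    esymm_succ_eq_update n k i (Function.update lam j 0),
    Function.update_comm hne.symm, Function.update_of_ne hne.symm, Function.update_of_ne hne]
  nlinarith [mul_le_mul_of_nonneg_right (hdec hij) hnn]
end

section
/- Let 5 ≤ k ≤ n. There exists ε > 0, depending only on n and k, with the following property: for every λ ∈ Γ_k with entries ordered λ₁ ≥ λ₂ ≥ ⋯ ≥ λ_n satisfying λ_k ≤ ε·λ₁, for every β ≥ 4 and every index i with 2 ≤ i ≤ n, one has λ₁ · σ_{k-2;1i}(λ) ≥ (1/2 + 1/β) · σ_{k-1;i}(λ). -/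
/-- `σ_{m;ij}(λ)`: the `m`-th elementary symmetric polynomial of `λ` with the entries
`λ_i` and `λ_j` replaced by `0`. -/
noncomputable def esymmDel2 (n m : ℕ) (i j : Fin n) (lam : Fin n → ℝ) : ℝ :=
  esymm n m (Function.update (Function.update lam i 0) j 0)

namespace Polynomial

/-- The derivative of a real-rooted polynomial is real-rooted. -/
theorem Splits.derivative_real {p : ℝ[X]} (hp : p.Splits) : p.derivative.Splits := by
  rw [splits_iff_card_roots] at hp ⊢
  have h1 := card_roots_le_derivative p
  have h2 := natDegree_derivative_le p
  have h3 := card_roots' (derivative p)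
  omega

theorem two_mul_coeff_prod_X_add_C_le (s : Multiset ℝ) :
    2 * ((s.map fun r => X + C r).prod.coeff 0 * (s.map fun r => X + C r).prod.coeff 2) ≤
      (s.map fun r => X + C r).prod.coeff 1 ^ 2 := by
  induction s using Multiset.induction_on with
  | empty => simp [coeff_one]
  | cons r s ih =>
    simp only [Multiset.map_cons, Multiset.prod_cons]
    generalize (s.map fun r => X + C r).prod = p at ih ⊢
    simp only [add_mul, coeff_add, coeff_C_mul, coeff_X_mul_zero, coeff_X_mul p 0,
      coeff_X_mul p 1, zero_add]
    nlinarith [mul_le_mul_of_nonneg_left ih (sq_nonneg r), sq_nonneg (p.coeff 0)]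

/-- Newton's inequality for the coefficients of a real-rooted polynomial. -/
theorem Splits.newton_coeff {p : ℝ[X]} (hp : p.Splits) (k : ℕ) :
    (k + 2) * (p.coeff k * p.coeff (k + 2)) ≤ (k + 1) * p.coeff (k + 1) ^ 2 := by
  induction k generalizing p with
  | zero =>
    obtain ⟨s, hs⟩ := splits_iff_exists_multiset'.1 hp
    have h := mul_le_mul_of_nonneg_left (two_mul_coeff_prod_X_add_C_le s)
      (sq_nonneg p.leadingCoeff)
    rw [hs]
    simp only [coeff_C_mul, Nat.cast_zero, zero_add]
    linarith
  | succ k ih =>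
    have h := ih hp.derivative_real
    simp only [coeff_derivative] at h
    push_cast at h ⊢
    have hpos : (0 : ℝ) < (k + 1) * (k + 2) := by positivity
    refine le_of_mul_le_mul_left ?_ hpos
    rw [show k + 1 + 2 = k + 2 + 1 from rfl]
    linarith

end Polynomial

namespace Multiset

theorem esymm_zero_right (s : Multiset ℝ) : s.esymm 0 = 1 := by
  simp [esymm]

theorem esymm_cons_succ (a : ℝ) (s : Multiset ℝ) (m : ℕ) :
    (a ::ₘ s).esymm (m + 1) = s.esymm (m + 1) + a * s.esymm m := by
  simp [esymm, powersetCard_cons, sum_map_mul_left]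

theorem esymm_zero_cons (s : Multiset ℝ) (m : ℕ) : ((0 : ℝ) ::ₘ s).esymm m = s.esymm m := by
  cases m with
  | zero => simp only [esymm_zero_right]
  | succ m => simp [esymm_cons_succ]

theorem esymm_eq_zero_of_card_lt {s : Multiset ℝ} {m : ℕ} (h : card s < m) : s.esymm m = 0 := by
  simp [esymm, powersetCard_eq_empty m h]

theorem esymm_one_right (s : Multiset ℝ) : s.esymm 1 = s.sum := by
  simp [esymm, powersetCard_one]

/-- A weak form of Newton's inequality for elementary symmetric functions. -/
theorem esymm_mul_esymm_le_sq (s : Multiset ℝ) (m : ℕ) :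
    s.esymm m * s.esymm (m + 2) ≤ s.esymm (m + 1) ^ 2 := by
  rcases lt_or_ge (card s) (m + 2) with h | h
  · rw [esymm_eq_zero_of_card_lt h, mul_zero]
    positivity
  · obtain ⟨k, hk⟩ := Nat.exists_eq_add_of_le h
    have hp : (s.map fun r => Polynomial.X + Polynomial.C r).prod.Splits := by
      refine Polynomial.Splits.multisetProd fun f hf => ?_
      obtain ⟨r, -, rfl⟩ := mem_map.1 hf
      exact Polynomial.Splits.X_add_C r
    have h := hp.newton_coeff k
    rw [prod_X_add_C_coeff s (by omega), prod_X_add_C_coeff s (by omega),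
      prod_X_add_C_coeff s (by omega), show card s - k = m + 2 by omega,
      show card s - (k + 1) = m + 1 by omega, show card s - (k + 2) = m by omega] at h
    have hk0 : (0 : ℝ) ≤ k := k.cast_nonneg
    by_contra! hlt
    nlinarith [mul_lt_mul_of_pos_left hlt (show (0 : ℝ) < k + 1 by positivity),
      sq_nonneg (s.esymm (m + 1))]

/-- Removing one entry of a vector in `Γ_{k+1}` gives a vector in `Γ_k`. -/
theorem esymm_pos_of_cons {a : ℝ} {s : Multiset ℝ} {k : ℕ}
    (h : ∀ j ≤ k + 1, 0 < (a ::ₘ s).esymm j) : ∀ j ≤ k, 0 < s.esymm j := by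
  intro j
  induction j with
  | zero => intro _; simp [esymm_zero_right]
  | succ j ih =>
    intro hj
    have h0 := ih (by omega)
    have h1 := h (j + 1) (by omega)
    have h2 := h (j + 2) (by omega)
    rw [esymm_cons_succ] at h1 h2
    have hN := esymm_mul_esymm_le_sq s j
    by_contra! hneg
    nlinarith [mul_pos h0 h2, mul_nonneg (neg_nonneg.2 hneg) h1.le]

/-- If at most `m` entries of a vector in `Γ_{m+1}` exceed `t ≥ 0`, then `σ_{m+1}` is bounded by a
multiple of `t σ_m`. -/
theorem esymm_succ_le_choose_mul {t : ℝ} (ht : 0 ≤ t) (s : Multiset ℝ) (m : ℕ)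
    (hs : ∀ j ≤ m + 1, 0 < s.esymm j) (hc : s.countP (t < ·) ≤ m) :
    s.esymm (m + 1) ≤ (card s).choose (m + 1) * t * s.esymm m := by
  induction hN : card s generalizing s m with
  | zero =>
    have := hs (m + 1) le_rfl
    rw [esymm_eq_zero_of_card_lt (by omega)] at this
    exact absurd this (lt_irrefl 0)
  | succ N ih =>
    cases m with
    | zero =>
      have hle : ∀ x ∈ s, x ≤ t := by
        simpa [countP_eq_zero] using hc
      have := sum_le_card_nsmul s t hle
      simpa [esymm_one_right, esymm_zero_right, hN] using this
    | succ m =>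
      have hs1 := hs 1 (by omega)
      rw [esymm_one_right] at hs1
      obtain ⟨a, ha, ha0, hac⟩ : ∃ a ∈ s, 0 ≤ a ∧ (s.erase a).countP (t < ·) ≤ m := by
        by_cases hex : ∃ a ∈ s, t < a
        · obtain ⟨a, ha, hta⟩ := hex
          refine ⟨a, ha, ht.trans hta.le, ?_⟩
          rw [← cons_erase ha, countP_cons_of_pos _ hta] at hc
          exact Nat.le_of_succ_le_succ hc
        · push Not at hex
          have hpos : ∃ a ∈ s, 0 ≤ a := by
            by_contra! hneg
            have := sum_le_card_nsmul s 0 fun x hx => (hneg x hx).le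
            simp only [smul_zero] at this
            linarith
          obtain ⟨a, ha, ha0⟩ := hpos
          refine ⟨a, ha, ha0, ?_⟩
          rw [countP_eq_zero.2 fun x hx => not_lt.2 (hex x (mem_of_mem_erase hx))]
          exact Nat.zero_le m
      obtain ⟨u, rfl⟩ := exists_cons_of_mem ha
      rw [erase_cons_head] at hac
      have hu : card u = N := by simpa using hN
      have hcone := esymm_pos_of_cons hs
      have hm0 := hcone m (by omega)
      have hm1 := hcone (m + 1) le_rfl
      have h1 := ih u m hcone hac hu
      have h2 : u.esymm (m + 2) ≤ N.choose (m + 2) * t * u.esymm (m + 1) := by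
        rcases le_or_gt (u.esymm (m + 2)) 0 with hle | hlt
        · exact hle.trans (by positivity)
        · refine ih u (m + 1) (fun j hj => ?_) (by omega) hu
          rcases Nat.lt_or_ge j (m + 2) with hj' | hj'
          · exact hcone j (by omega)
          · rwa [show j = m + 2 by omega]
      rw [esymm_cons_succ, esymm_cons_succ, Nat.choose_succ_succ, Nat.cast_add]
      have h3 := mul_le_mul_of_nonneg_left h1 ha0
      have h4 : 0 ≤ (N.choose (m + 1) : ℝ) * t * u.esymm (m + 1) := by positivity
      have h5 : 0 ≤ (N.choose (m + 2) : ℝ) * t * (a * u.esymm m) := by positivity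
      linarith

end Multiset

theorem esymm_eq_multiset_esymm (n m : ℕ) (lam : Fin n → ℝ) :
    esymm n m lam = (Finset.univ.val.map lam).esymm m :=
  (Finset.esymm_map_val lam Finset.univ m).symm

theorem map_univ_eq_cons_erase {n : ℕ} (i : Fin n) (f : Fin n → ℝ) :
    Finset.univ.val.map f = f i ::ₘ (Finset.univ.erase i).val.map f := by
  rw [← Multiset.map_cons, Finset.erase_val, Multiset.cons_erase (Finset.mem_univ_val i)]

theorem esymmDel_eq (n m : ℕ) (i : Fin n) (lam : Fin n → ℝ) :
    esymmDel n m i lam = ((Finset.univ.erase i).val.map lam).esymm m := by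
  rw [esymmDel, esymm_eq_multiset_esymm, map_univ_eq_cons_erase i, Function.update_self,
    Multiset.esymm_zero_cons]
  congr 1
  refine Multiset.map_congr rfl fun x hx => Function.update_of_ne ?_ _ _
  rw [Finset.mem_val] at hx
  exact Finset.ne_of_mem_erase hx

theorem map_erase_eq_cons_erase {n : ℕ} {i j : Fin n} (hij : i ≠ j) (f : Fin n → ℝ) :
    (Finset.univ.erase j).val.map f = f i ::ₘ ((Finset.univ.erase j).erase i).val.map f := by
  rw [← Multiset.map_cons, Finset.erase_val (Finset.univ.erase j) i,
    Multiset.cons_erase (Finset.mem_erase.2 ⟨hij, Finset.mem_univ i⟩)]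

theorem esymmDel2_eq (n m : ℕ) {i j : Fin n} (hij : i ≠ j) (lam : Fin n → ℝ) :
    esymmDel2 n m i j lam = (((Finset.univ.erase j).erase i).val.map lam).esymm m := by
  have h := esymmDel_eq n m j (Function.update lam i 0)
  rw [esymmDel, map_erase_eq_cons_erase hij, Function.update_self, Multiset.esymm_zero_cons] at h
  rw [esymmDel2, h]
  congr 1
  refine Multiset.map_congr rfl fun x hx => Function.update_of_ne ?_ _ _
  rw [Finset.mem_val] at hx
  exact Finset.ne_of_mem_erase hx

/-- for `5 ≤ k ≤ n` there exists `ε > 0` depending only on `n, k` such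
that for every `λ ∈ Γ_k` with decreasingly ordered entries satisfying `λ_k ≤ ε λ₁`,
every `β ≥ 4` and every index `2 ≤ i ≤ n` (i.e. `Fin`-index with `1 ≤ i`),
`λ₁ σ_{k-2;1i}(λ) ≥ (1/2 + 1/β) σ_{k-1;i}(λ)`. -/
theorem stmt14 (n k : ℕ) (hk : 5 ≤ k) (hkn : k ≤ n) :
    ∃ ε : ℝ, 0 < ε ∧ ∀ lam ∈ GardingCone n k, Antitone lam →
      lam ⟨k - 1, by omega⟩ ≤ ε * lam ⟨0, by omega⟩ →
      ∀ β : ℝ, 4 ≤ β → ∀ i : Fin n, 1 ≤ (i : ℕ) →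
        lam ⟨0, by omega⟩ * esymmDel2 n (k - 2) ⟨0, by omega⟩ i lam ≥
          (1 / 2 + 1 / β) * esymmDel n (k - 1) i lam := by
  obtain ⟨p, rfl⟩ : ∃ p, k = p + 2 := ⟨k - 2, by omega⟩
  obtain ⟨K, hK⟩ : ∃ K : ℝ, K = (n - 2).choose (p + 1) := ⟨_, rfl⟩
  have hK0 : 0 ≤ K := hK ▸ Nat.cast_nonneg _
  refine ⟨1 / (3 * (K + 1)), by positivity, fun lam hlam hanti hle β hβ i hi => ?_⟩
  obtain ⟨o, ho⟩ : ∃ o : Fin n, o = ⟨0, by omega⟩ := ⟨_, rfl⟩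
  rw [← ho] at hle ⊢
  have hoi : o ≠ i := by
    rintro rfl
    simp [ho] at hi
  set E := (Finset.univ.erase i).erase o with hE
  set s := E.val.map lam with hs
  have hcone : ∀ j ≤ p + 2, 0 < (Finset.univ.val.map lam).esymm j := by
    intro j hj
    rcases Nat.eq_zero_or_pos j with rfl | hj0
    · simp [Multiset.esymm_zero_right]
    · rw [← esymm_eq_multiset_esymm]
      exact hlam j hj0 hj
  have ho0 : 0 ≤ lam o := by
    have h1 := hcone 1 (by omega)
    rw [Multiset.esymm_one_right] at h1
    by_contra! hneg
    have : ∑ x, lam x ≤ 0 := Finset.sum_nonpos fun x _ => (hanti (ho ▸ Nat.zero_le x)).trans hneg.le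
    exact absurd h1 (not_lt.2 this)
  rw [map_univ_eq_cons_erase i, map_erase_eq_cons_erase hoi] at hcone
  have hcone1 := Multiset.esymm_pos_of_cons hcone
  have hcone2 := Multiset.esymm_pos_of_cons hcone1
  rw [esymmDel2_eq n _ hoi, esymmDel_eq, map_erase_eq_cons_erase hoi]
  simp only [Nat.add_sub_cancel, show p + 2 - 1 = p + 1 from rfl] at hle ⊢
  have hpos := hcone1 (p + 1) le_rfl
  rw [← hE, ← hs] at hpos hcone2 ⊢
  rw [Multiset.esymm_cons_succ] at hpos ⊢
  have hp0 := hcone2 p le_rfl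
  have hβ' : 1 / β ≤ 1 / 4 := one_div_le_one_div_of_le (by norm_num) hβ
  suffices h : 3 * s.esymm (p + 1) ≤ lam o * s.esymm p by
    have := mul_le_mul_of_nonneg_right hβ' hpos.le
    linarith
  have hprod : 0 ≤ lam o * s.esymm p := mul_nonneg ho0 hp0.le
  rcases le_or_gt (s.esymm (p + 1)) 0 with hneg | hp1
  · linarith
  set t : ℝ := 1 / (3 * (K + 1)) * lam o with ht
  have hcard : Multiset.card s = n - 2 := by
    rw [hs, Multiset.card_map, Finset.card_val, hE, Finset.card_erase_of_mem (by simp [hoi]),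
      Finset.card_erase_of_mem (Finset.mem_univ i), Finset.card_univ, Fintype.card_fin]
    omega
  have hcount : s.countP (t < ·) ≤ p := by
    rw [hs, Multiset.countP_map, ← Finset.filter_val, Finset.card_val,
      ← Finset.card_map Fin.valEmbedding]
    refine (Finset.card_le_card (t := Finset.Icc 1 p) fun x hx => ?_).trans (by simp)
    simp only [Finset.mem_map, Finset.mem_filter, Fin.valEmbedding_apply] at hx
    obtain ⟨y, ⟨hyE, hy⟩, rfl⟩ := hx
    have hyo : (y : ℕ) ≠ 0 := fun h => Finset.ne_of_mem_erase hyE (ho ▸ Fin.ext h)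
    have hyp : (y : ℕ) < p + 1 := by
      by_contra! hge
      exact absurd (hy.trans_le (hanti (show (⟨p + 1, by omega⟩ : Fin n) ≤ y from hge)))
        (not_lt.2 hle)
    rw [Finset.mem_Icc]
    omega
  have hbound := Multiset.esymm_succ_le_choose_mul (by positivity : 0 ≤ t) s p
    (fun j hj => by
      rcases Nat.lt_or_ge j (p + 1) with hj' | hj'
      · exact hcone2 j (by omega)
      · rwa [show j = p + 1 by omega]) hcount
  rw [hcard, ← hK] at hbound
  have hKt : 3 * (K * t) ≤ lam o := by
    have h3 : 3 * (K + 1) * t = lam o := by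
      rw [ht]
      field_simp
    have : 0 ≤ t := by positivity
    linarith
  have := mul_le_mul_of_nonneg_right hKt hp0.le
  linarith
end
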